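/- arXiv:2507.07774 — 6 statements merged into one kernel-verified Lean document; each statement's English description precedes it below -/
import Mathlib

section
/- Let X and Y be real normed linear spaces, let 1 ≤ p < ∞, and let Z = X ⊕_p Y be their p-direct sum. Let z₁ = (x₁, y₁) and z₂ = (x₂, y₂) with x₁, x₂ ∈ X nonzero and y₁, y₂ ∈ Y nonzero. If (z₁, z₂) is a parallel pair in Z, then (x₁, x₂) is a parallel pair in X and (y₁, y₂) is a parallel pair in Y. -/
def IsParallelPair {E : Type*} [NormedAddCommGroup E] [NormedSpace ℝ E] (x y : E) : Prop :=
  ∃ lam : ℝ, |lam| = 1 ∧ ‖x + lam • y‖ = ‖x‖ + ‖y‖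

lemma WithLp.prod_norm_le_prod_norm {X Y X' Y' : Type*}
    [NormedAddCommGroup X] [NormedAddCommGroup Y] [NormedAddCommGroup X'] [NormedAddCommGroup Y']
    {p : ENNReal} (hp : 0 < p.toReal) {z : WithLp p (X × Y)} {w : WithLp p (X' × Y')}
    (h₁ : ‖z.fst‖ ≤ ‖w.fst‖) (h₂ : ‖z.snd‖ ≤ ‖w.snd‖) : ‖z‖ ≤ ‖w‖ := by
  rw [prod_norm_eq_add hp, prod_norm_eq_add hp]
  gcongr

/-- The `p`-norm on a product is strictly monotone in the component norms: if the component norms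
of `z` are at most those of `w` but `‖w‖ ≤ ‖z‖`, then the component norms agree. -/
lemma WithLp.norm_fst_eq_and_norm_snd_eq_of_norm_le {X Y X' Y' : Type*}
    [NormedAddCommGroup X] [NormedAddCommGroup Y] [NormedAddCommGroup X'] [NormedAddCommGroup Y']
    {p : ENNReal} (hp : 0 < p.toReal) {z : WithLp p (X × Y)} {w : WithLp p (X' × Y')}
    (h₁ : ‖z.fst‖ ≤ ‖w.fst‖) (h₂ : ‖z.snd‖ ≤ ‖w.snd‖) (h : ‖w‖ ≤ ‖z‖) :
    ‖z.fst‖ = ‖w.fst‖ ∧ ‖z.snd‖ = ‖w.snd‖ := by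
  rw [prod_norm_eq_add hp, prod_norm_eq_add hp,
    Real.rpow_le_rpow_iff (by positivity) (by positivity) (by positivity)] at h
  have h₁' := Real.rpow_le_rpow (norm_nonneg _) h₁ hp.le
  have h₂' := Real.rpow_le_rpow (norm_nonneg _) h₂ hp.le
  exact ⟨(Real.rpow_left_inj (norm_nonneg _) (norm_nonneg _) hp.ne').1 (by linarith),
    (Real.rpow_left_inj (norm_nonneg _) (norm_nonneg _) hp.ne').1 (by linarith)⟩

lemma norm_add_smul_le_norm_norm_add_norm {E : Type*} [NormedAddCommGroup E] [NormedSpace ℝ E]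
    {lam : ℝ} (hlam : |lam| = 1) (u v : E) : ‖u + lam • v‖ ≤ ‖‖u‖ + ‖v‖‖ := by
  rw [Real.norm_of_nonneg (by positivity)]
  simpa [norm_smul, hlam] using norm_add_le u (lam • v)

theorem parallel_pair_prodLp
    {X Y : Type*} [NormedAddCommGroup X] [NormedSpace ℝ X]
    [NormedAddCommGroup Y] [NormedSpace ℝ Y]
    (hdimX : 1 < Module.rank ℝ X) (hdimY : 1 < Module.rank ℝ Y)
    (p : ENNReal) [Fact (1 ≤ p)] (hp : p ≠ ⊤)
    (x₁ x₂ : X) (y₁ y₂ : Y) (hx₁ : x₁ ≠ 0) (hx₂ : x₂ ≠ 0) (hy₁ : y₁ ≠ 0) (hy₂ : y₂ ≠ 0)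
    (h : IsParallelPair ((WithLp.equiv p (X × Y)).symm (x₁, y₁))
      ((WithLp.equiv p (X × Y)).symm (x₂, y₂))) :
    IsParallelPair x₁ x₂ ∧ IsParallelPair y₁ y₂ := by
  obtain ⟨lam, hlam, h⟩ := h
  have hp0 : 0 < p.toReal :=
    ENNReal.toReal_pos (zero_lt_one.trans_le (Fact.out : 1 ≤ p)).ne' hp
  let a : WithLp p (ℝ × ℝ) := WithLp.toLp p (‖x₁‖, ‖y₁‖)
  let b : WithLp p (ℝ × ℝ) := WithLp.toLp p (‖x₂‖, ‖y₂‖)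
  have ha : ‖a‖ ≤ ‖(WithLp.equiv p (X × Y)).symm (x₁, y₁)‖ :=
    WithLp.prod_norm_le_prod_norm hp0 (by simp [a]) (by simp [a])
  have hb : ‖b‖ ≤ ‖(WithLp.equiv p (X × Y)).symm (x₂, y₂)‖ :=
    WithLp.prod_norm_le_prod_norm hp0 (by simp [b]) (by simp [b])
  have key := WithLp.norm_fst_eq_and_norm_snd_eq_of_norm_le hp0
    (z := (WithLp.equiv p (X × Y)).symm (x₁, y₁) + lam • (WithLp.equiv p (X × Y)).symm (x₂, y₂))
    (w := a + b)
    (norm_add_smul_le_norm_norm_add_norm hlam x₁ x₂)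
    (norm_add_smul_le_norm_norm_add_norm hlam y₁ y₂)
    (by rw [h]; exact (norm_add_le a b).trans (add_le_add ha hb))
  have norm_add_of_nonneg {s t : ℝ} (hs : 0 ≤ s) (ht : 0 ≤ t) : ‖s + t‖ = s + t :=
    Real.norm_of_nonneg (add_nonneg hs ht)
  exact ⟨⟨lam, hlam, key.1.trans (norm_add_of_nonneg (norm_nonneg x₁) (norm_nonneg x₂))⟩,
    ⟨lam, hlam, key.2.trans (norm_add_of_nonneg (norm_nonneg y₁) (norm_nonneg y₂))⟩⟩
end

section
/- Let X and Y be real normed linear spaces, let 1 ≤ p < ∞, and let Z = X ⊕_p Y be their p-direct sum. Let z₁ = (x₁, y₁) and z₂ = (x₂, y₂) with x₁, x₂ ∈ X nonzero and y₁, y₂ ∈ Y nonzero. If ‖z₁ + z₂‖ = ‖z₁‖ + ‖z₂‖, then ‖x₁ + x₂‖ = ‖x₁‖ + ‖x₂‖ and ‖y₁ + y₂‖ = ‖y₁‖ + ‖y₂‖. -/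
/-- The `p`-norm of a pair only depends on the norms of its coordinates. -/
theorem WithLp.norm_prod_eq_norm_norms {X Y : Type*} [NormedAddCommGroup X] [NormedAddCommGroup Y]
    {p : ENNReal} (hp : 0 < p.toReal) (x : X) (y : Y) :
    ‖WithLp.toLp p (x, y)‖ = ‖WithLp.toLp p (‖x‖, ‖y‖)‖ := by
  simp [WithLp.prod_norm_eq_add hp]

/-- The `p`-norm is strictly monotone: a coordinatewise smaller pair of at least the same norm
has the same coordinates. -/
theorem WithLp.eq_and_eq_of_norm_prod_le {p : ENNReal} (hp : 0 < p.toReal) {a b c d : ℝ}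
    (ha : 0 ≤ a) (hb : 0 ≤ b) (hac : a ≤ c) (hbd : b ≤ d)
    (h : ‖WithLp.toLp p (c, d)‖ ≤ ‖WithLp.toLp p (a, b)‖) : a = c ∧ b = d := by
  have hc := ha.trans hac
  have hd := hb.trans hbd
  simp only [WithLp.prod_norm_eq_add hp, WithLp.toLp_fst, WithLp.toLp_snd,
    Real.norm_of_nonneg, ha, hb, hc, hd] at h
  rw [Real.rpow_le_rpow_iff (by positivity) (by positivity) (by positivity)] at h
  have h₁ := Real.rpow_le_rpow ha hac hp.le
  have h₂ := Real.rpow_le_rpow hb hbd hp.le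
  exact ⟨(Real.rpow_left_inj ha hc hp.ne').1 (by linarith),
    (Real.rpow_left_inj hb hd hp.ne').1 (by linarith)⟩

theorem tea_pair_prodLp
    {X Y : Type*} [NormedAddCommGroup X] [NormedSpace ℝ X]
    [NormedAddCommGroup Y] [NormedSpace ℝ Y]
    (hdimX : 1 < Module.rank ℝ X) (hdimY : 1 < Module.rank ℝ Y)
    (p : ENNReal) [Fact (1 ≤ p)] (hp : p ≠ ⊤)
    (x₁ x₂ : X) (y₁ y₂ : Y) (hx₁ : x₁ ≠ 0) (hx₂ : x₂ ≠ 0) (hy₁ : y₁ ≠ 0) (hy₂ : y₂ ≠ 0)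
    (h : ‖(WithLp.equiv p (X × Y)).symm (x₁, y₁) + (WithLp.equiv p (X × Y)).symm (x₂, y₂)‖ =
      ‖(WithLp.equiv p (X × Y)).symm (x₁, y₁)‖ + ‖(WithLp.equiv p (X × Y)).symm (x₂, y₂)‖) :
    ‖x₁ + x₂‖ = ‖x₁‖ + ‖x₂‖ ∧ ‖y₁ + y₂‖ = ‖y₁‖ + ‖y₂‖ := by
  have hp₀ : 0 < p.toReal :=
    ENNReal.toReal_pos (zero_lt_one.trans_le (Fact.out : 1 ≤ p)).ne' hp
  refine WithLp.eq_and_eq_of_norm_prod_le hp₀ (norm_nonneg _) (norm_nonneg _)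
    (norm_add_le _ _) (norm_add_le _ _) ?_
  change ‖WithLp.toLp p (x₁ + x₂, y₁ + y₂)‖ =
    ‖WithLp.toLp p (x₁, y₁)‖ + ‖WithLp.toLp p (x₂, y₂)‖ at h
  rw [← WithLp.norm_prod_eq_norm_norms hp₀, h, WithLp.norm_prod_eq_norm_norms hp₀ x₁,
    WithLp.norm_prod_eq_norm_norms hp₀ x₂]
  exact norm_add_le (WithLp.toLp p (‖x₁‖, ‖y₁‖)) (WithLp.toLp p (‖x₂‖, ‖y₂‖))
end

section
/- Let X and Y be real normed linear spaces and let Z = X ⊕_∞ Y. Let z₁ = (x₁, y₁) and z₂ = (x₂, y₂) be nonzero elements of Z. If either (‖x₁‖ > ‖y₁‖ and ‖x₂‖ < ‖y₂‖) or (‖x₁‖ < ‖y₁‖ and ‖x₂‖ > ‖y₂‖), then (z₁, z₂) is not a parallel pair in Z. -/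
theorem not_parallel_pair_prodLinfty_mixed_dominance
    {X Y : Type*} [NormedAddCommGroup X] [NormedSpace ℝ X]
    [NormedAddCommGroup Y] [NormedSpace ℝ Y]
    (hdimX : 1 < Module.rank ℝ X) (hdimY : 1 < Module.rank ℝ Y)
    (x₁ x₂ : X) (y₁ y₂ : Y)
    (hz₁ : ¬(x₁ = 0 ∧ y₁ = 0)) (hz₂ : ¬(x₂ = 0 ∧ y₂ = 0))
    (h : (‖y₁‖ < ‖x₁‖ ∧ ‖x₂‖ < ‖y₂‖) ∨ (‖x₁‖ < ‖y₁‖ ∧ ‖y₂‖ < ‖x₂‖)) :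
    ¬ IsParallelPair ((WithLp.equiv ⊤ (X × Y)).symm (x₁, y₁))
        ((WithLp.equiv ⊤ (X × Y)).symm (x₂, y₂)) := by
  rintro ⟨lam, hlam, heq⟩
  have hx : ‖x₁ + lam • x₂‖ ≤ ‖x₁‖ + ‖x₂‖ := by
    simpa [norm_smul, hlam] using norm_add_le x₁ (lam • x₂)
  have hy : ‖y₁ + lam • y₂‖ ≤ ‖y₁‖ + ‖y₂‖ := by
    simpa [norm_smul, hlam] using norm_add_le y₁ (lam • y₂)
  simp only [WithLp.prod_norm_eq_sup] at heq
  change max ‖x₁ + lam • x₂‖ ‖y₁ + lam • y₂‖ = max ‖x₁‖ ‖y₁‖ + max ‖x₂‖ ‖y₂‖ at heq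
  refine (max_lt ?_ ?_).ne heq
  all_goals
    rcases h with ⟨h₁, h₂⟩ | ⟨h₁, h₂⟩
    · rw [max_eq_left h₁.le, max_eq_right h₂.le]
      linarith
    · rw [max_eq_right h₁.le, max_eq_left h₂.le]
      linarith
end

section
/- Let X be a real normed linear space and let F be a k-face of the unit ball B_X for some natural number k ≥ 1. Then for each x in the relative interior of F, there exist k + 1 linearly independent elements x₀, x₁, …, x_k of F such that x = (1/(k+1)) (x₀ + x₁ + ⋯ + x_k). -/
open Metric

/-- A face of the unit ball: a convex subset of the unit sphere such that whenever a proper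
convex combination of two unit vectors lies in it, both vectors lie in it. -/
def IsFace {E : Type*} [NormedAddCommGroup E] [NormedSpace ℝ E] (F : Set E) : Prop :=
  F ⊆ sphere (0 : E) 1 ∧ Convex ℝ F ∧
    ∀ x₁ ∈ sphere (0 : E) 1, ∀ x₂ ∈ sphere (0 : E) 1, ∀ t : ℝ, 0 < t → t < 1 →
      (1 - t) • x₁ + t • x₂ ∈ F → x₁ ∈ F ∧ x₂ ∈ F

/-- A `k`-face: a face whose affine hull has dimension `k`. -/
def IsKFace {E : Type*} [NormedAddCommGroup E] [NormedSpace ℝ E] (k : ℕ) (F : Set E) : Prop :=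
  IsFace F ∧ Module.finrank ℝ (affineSpan ℝ F).direction = k

/-- The relative interior of a set `F`. -/
def relInt {E : Type*} [NormedAddCommGroup E] [NormedSpace ℝ E] (F : Set E) : Set E :=
  {x ∈ F | ∃ ε > 0, (affineSpan ℝ F : Set E) ∩ ball x ε ⊆ F}

/-- If `b` is a linearly independent family in a submodule `D` and `x ∉ D`, then the points
`x - ∑ i, b i`, `x + b i` are linearly independent. -/
theorem linearIndependent_cons_sub_sum_add {V : Type*} [AddCommGroup V] [Module ℝ V] {k : ℕ}
    {D : Submodule ℝ V} {b : Fin k → V} (hb : LinearIndependent ℝ b) (hbD : ∀ i, b i ∈ D)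
    {x : V} (hx : x ∉ D) :
    LinearIndependent ℝ (Fin.cons (x - ∑ i, b i) (fun i => x + b i) : Fin (k + 1) → V) := by
  rw [Fintype.linearIndependent_iff]
  intro g hg
  have key : (∑ i, g i) • x + ∑ i : Fin k, (g i.succ - g 0) • b i = 0 := by
    rw [← hg]
    simp only [Fin.sum_univ_succ, Fin.cons_zero, Fin.cons_succ, smul_add, smul_sub, sub_smul,
      add_smul, Finset.sum_add_distrib, Finset.sum_sub_distrib, Finset.sum_smul, Finset.smul_sum]
    abel
  have hsum : ∑ i, g i = 0 := by
    by_contra hne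
    refine hx ((D.smul_mem_iff hne).1 ?_)
    rw [eq_neg_of_add_eq_zero_left key]
    exact D.neg_mem (D.sum_mem fun i _ => D.smul_mem _ (hbD i))
  rw [hsum, zero_smul, zero_add] at key
  have heq : ∀ i : Fin k, g i.succ = g 0 := fun i =>
    sub_eq_zero.1 (Fintype.linearIndependent_iff.1 hb _ key i)
  have hzero : g 0 = 0 := by
    rw [Fin.sum_univ_succ, Finset.sum_congr rfl fun i _ => heq i, Finset.sum_const,
      Finset.card_univ, Fintype.card_fin, nsmul_eq_mul] at hsum
    have hpos : (0 : ℝ) < 1 + k := by positivity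
    have hmul : (1 + (k : ℝ)) * g 0 = 0 := by linarith
    exact (mul_eq_zero.1 hmul).resolve_left hpos.ne'
  intro i
  refine Fin.cases hzero (fun j => ?_) i
  rw [heq j, hzero]

/-- Small translates of a relative interior point along the direction of the affine span stay in
the set. -/
theorem exists_pos_forall_add_mem_of_mem_relInt {E : Type*} [NormedAddCommGroup E]
    [NormedSpace ℝ E] {F : Set E} {x : E} (hx : x ∈ relInt F) :
    ∃ ε > 0, ∀ d ∈ (affineSpan ℝ F).direction, ‖d‖ < ε → x + d ∈ F := by
  obtain ⟨hxF, ε, hε, hsub⟩ := hx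
  refine ⟨ε, hε, fun d hd hlt => hsub ⟨?_, by simpa using hlt⟩⟩
  have h := AffineSubspace.vadd_mem_of_mem_direction hd (subset_affineSpan ℝ F hxF)
  rwa [vadd_eq_add, add_comm] at h

/-- A relative interior point of a subset of the unit sphere does not lie in the direction of the
affine span. -/
theorem notMem_direction_of_mem_relInt {E : Type*} [NormedAddCommGroup E] [NormedSpace ℝ E]
    {F : Set E} (hF : F ⊆ sphere (0 : E) 1) {x : E} (hx : x ∈ relInt F) :
    x ∉ (affineSpan ℝ F).direction := by
  intro hxD
  obtain ⟨ε, hε, hadd⟩ := exists_pos_forall_add_mem_of_mem_relInt hx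
  have hx1 : ‖x‖ = 1 := by simpa using hF hx.1
  have hmem := hF (hadd ((ε / 2) • x) (Submodule.smul_mem _ _ hxD) (by
    rw [norm_smul, hx1, Real.norm_of_nonneg (by positivity)]; linarith))
  have hone : x + (ε / 2) • x = (1 + ε / 2) • x := by rw [add_smul, one_smul]
  rw [hone, mem_sphere_zero_iff_norm, norm_smul, hx1, Real.norm_of_nonneg (by positivity)] at hmem
  linarith

theorem relint_point_mean_of_lin_indep
    {X : Type*} [NormedAddCommGroup X] [NormedSpace ℝ X]
    (hdim : 1 < Module.rank ℝ X)
    (k : ℕ) (hk : 1 ≤ k) (F : Set X) (hF : IsKFace k F) :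
    ∀ x ∈ relInt F, ∃ v : Fin (k + 1) → X, LinearIndependent ℝ v ∧ (∀ i, v i ∈ F) ∧
      x = (1 / ((k : ℝ) + 1)) • ∑ i, v i := by
  intro x hx
  obtain ⟨⟨hsphere, -, -⟩, hrank⟩ := hF
  set D := (affineSpan ℝ F).direction with hD
  have hfin : Module.Finite ℝ D := Module.finite_of_finrank_pos (by omega)
  let b := Module.finBasisOfFinrankEq ℝ D hrank
  obtain ⟨ε, hε, hadd⟩ := exists_pos_forall_add_mem_of_mem_relInt hx
  obtain ⟨c, hc, hcb, hcs⟩ : ∃ c : ℝ, 0 < c ∧ (∀ i, ‖c • (b i : X)‖ < ε) ∧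
      ‖-∑ i, c • (b i : X)‖ < ε := by
    set M := ∑ i, ‖(b i : X)‖ with hM
    have hM0 : 0 ≤ M := Finset.sum_nonneg fun i _ => norm_nonneg _
    have hc : 0 < ε / (M + 1) := by positivity
    have hlt : ε / (M + 1) * M < ε := by
      rw [div_mul_eq_mul_div, div_lt_iff₀ (by positivity)]
      nlinarith
    refine ⟨ε / (M + 1), hc, fun i => ?_, ?_⟩
    · rw [norm_smul, Real.norm_of_nonneg hc.le]
      refine lt_of_le_of_lt (mul_le_mul_of_nonneg_left ?_ hc.le) hlt
      exact Finset.single_le_sum (f := fun i => ‖(b i : X)‖) (fun i _ => norm_nonneg _)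
        (Finset.mem_univ i)
    · rw [norm_neg, ← Finset.smul_sum, norm_smul, Real.norm_of_nonneg hc.le]
      exact lt_of_le_of_lt (mul_le_mul_of_nonneg_left (norm_sum_le _ _) hc.le) hlt
  have hmem : ∀ i, c • (b i : X) ∈ D := fun i => D.smul_mem _ (b i).2
  have hli : LinearIndependent ℝ fun i => c • (b i : X) :=
    (b.linearIndependent.map' D.subtype D.ker_subtype).units_smul fun _ => Units.mk0 c hc.ne'
  refine ⟨_, linearIndependent_cons_sub_sum_add hli hmem
    (notMem_direction_of_mem_relInt hsphere hx), fun i => ?_, ?_⟩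
  · refine Fin.cases ?_ (fun j => ?_) i
    · rw [Fin.cons_zero, sub_eq_add_neg]
      exact hadd _ (D.neg_mem (D.sum_mem fun i _ => hmem i)) hcs
    · rw [Fin.cons_succ]
      exact hadd _ (hmem j) (hcb j)
  · have hk0 : (k : ℝ) + 1 ≠ 0 := by positivity
    rw [Fin.sum_univ_succ]
    simp only [Fin.cons_zero, Fin.cons_succ, Finset.sum_add_distrib, Finset.sum_const,
      Finset.card_univ, Fintype.card_fin]
    rw [← Nat.cast_smul_eq_nsmul ℝ, eq_comm, one_div, inv_smul_eq_iff₀ hk0, add_smul, one_smul]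
    abel
end

section
/- Let X and Y be real normed linear spaces and let F be a k-face of the unit ball B_X for some natural number k ≥ 1. If a bounded linear operator T : X → Y maps every TEA pair contained in F to a TEA pair (i.e., for all x, y ∈ F with ‖x + y‖ = ‖x‖ + ‖y‖ one has ‖Tx + Ty‖ = ‖Tx‖ + ‖Ty‖), then either T(F) = {0} or the relative interior of F contains no element of the kernel of T. -/
open Metric

def IsTEAPair {E : Type*} [NormedAddCommGroup E] (x y : E) : Prop :=
  ‖x + y‖ = ‖x‖ + ‖y‖

/-- Any two points of a face of the unit ball form a TEA pair. -/
theorem IsFace.isTEAPair {E : Type*} [NormedAddCommGroup E] [NormedSpace ℝ E] {F : Set E}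
    (hF : IsFace F) {x y : E} (hx : x ∈ F) (hy : y ∈ F) : IsTEAPair x y := by
  have hmid : (1 / 2 : ℝ) • x + (1 / 2 : ℝ) • y ∈ F :=
    hF.2.1 hx hy (by norm_num) (by norm_num) (by norm_num)
  have hnorm := mem_sphere_zero_iff_norm.1 (hF.1 hmid)
  rw [← smul_add, norm_smul, Real.norm_of_nonneg (by norm_num)] at hnorm
  rw [IsTEAPair, mem_sphere_zero_iff_norm.1 (hF.1 hx), mem_sphere_zero_iff_norm.1 (hF.1 hy)]
  linarith

/-- A segment from a point of a set to a point of its relative interior can be prolonged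
slightly beyond the latter inside the set. -/
theorem exists_pos_lineMap_neg_mem_of_mem_relInt {E : Type*} [NormedAddCommGroup E]
    [NormedSpace ℝ E] {F : Set E} {x y : E} (hx : x ∈ relInt F) (hy : y ∈ F) :
    ∃ δ : ℝ, 0 < δ ∧ AffineMap.lineMap x y (-δ) ∈ F := by
  obtain ⟨hxF, ε, hε, hball⟩ := hx
  have hpos : 0 < ‖x - y‖ + 1 := by positivity
  refine ⟨ε / (‖x - y‖ + 1), by positivity, hball ⟨?_, ?_⟩⟩
  · exact AffineMap.lineMap_mem _ (subset_affineSpan ℝ F hxF) (subset_affineSpan ℝ F hy)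
  · rw [mem_ball, dist_lineMap_left, norm_neg, Real.norm_of_nonneg (by positivity),
      dist_eq_norm, div_mul_eq_mul_div, div_lt_iff₀ hpos]
    nlinarith

theorem preserves_tea_on_face_kernel_avoids_relint
    {X Y : Type*} [NormedAddCommGroup X] [NormedSpace ℝ X]
    [NormedAddCommGroup Y] [NormedSpace ℝ Y]
    (hdimX : 1 < Module.rank ℝ X) (hdimY : 1 < Module.rank ℝ Y)
    (k : ℕ) (hk : 1 ≤ k) (F : Set X) (hF : IsKFace k F) (T : X →L[ℝ] Y)
    (hT : ∀ x ∈ F, ∀ y ∈ F, IsTEAPair x y → IsTEAPair (T x) (T y)) :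
    (∀ x ∈ F, T x = 0) ∨ ∀ x ∈ relInt F, T x ≠ 0 := by
  by_contra! h
  obtain ⟨⟨y, hy, hTy⟩, x, hx, hTx⟩ := h
  obtain ⟨δ, hδ, hz⟩ := exists_pos_lineMap_neg_mem_of_mem_relInt hx hy
  have hTEA := hT y hy _ hz (hF.1.isTEAPair hy hz)
  have hTz : T (AffineMap.lineMap x y (-δ)) = (-δ) • T y := by
    simp [AffineMap.lineMap_apply, hTx]
  have hsum : T y + (-δ) • T y = (1 - δ) • T y := by module
  rw [IsTEAPair, hTz, hsum, norm_smul, norm_smul, norm_neg, Real.norm_of_nonneg hδ.le,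
    Real.norm_eq_abs] at hTEA
  have hlt : |1 - δ| < 1 + δ := abs_lt.2 ⟨by linarith, by linarith⟩
  nlinarith [norm_pos_iff.2 hTy]
end

section
/- Let X and Y be finite-dimensional real Banach spaces and let T : X → Y be a bijective bounded linear operator. Then T preserves parallel pairs if and only if T preserves TEA pairs. -/
theorem IsTEAPair.norm_smul_add_smul_of_le {E : Type*} [NormedAddCommGroup E] [NormedSpace ℝ E]
    {x y : E} (h : IsTEAPair x y) {a b : ℝ} (hb : 0 ≤ b) (hab : b ≤ a) :
    ‖a • x + b • y‖ = a * ‖x‖ + b * ‖y‖ := by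
  have ha : 0 ≤ a := hb.trans hab
  apply le_antisymm
  · simpa [norm_smul, abs_of_nonneg ha, abs_of_nonneg hb] using norm_add_le (a • x) (b • y)
  · have key := norm_add_le (a • x + b • y) ((a - b) • y)
    have e : a • x + b • y + (a - b) • y = a • (x + y) := by module
    rw [e, norm_smul_of_nonneg ha, norm_smul_of_nonneg (sub_nonneg.2 hab), h] at key
    linarith

theorem IsTEAPair.symm {E : Type*} [NormedAddCommGroup E] {x y : E} (h : IsTEAPair x y) :
    IsTEAPair y x := by
  unfold IsTEAPair at *
  rw [add_comm, h, add_comm]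

theorem IsTEAPair.norm_smul_add_smul {E : Type*} [NormedAddCommGroup E] [NormedSpace ℝ E]
    {x y : E} (h : IsTEAPair x y) {a b : ℝ} (ha : 0 ≤ a) (hb : 0 ≤ b) :
    ‖a • x + b • y‖ = a * ‖x‖ + b * ‖y‖ := by
  rcases le_total b a with hab | hab
  · exact h.norm_smul_add_smul_of_le hb hab
  · rw [add_comm, h.symm.norm_smul_add_smul_of_le ha hab, add_comm]

theorem IsTEAPair.conical_combinations {E : Type*} [NormedAddCommGroup E] [NormedSpace ℝ E]
    {x y : E} (h : IsTEAPair x y) {a b c d : ℝ} (ha : 0 ≤ a) (hb : 0 ≤ b) (hc : 0 ≤ c)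
    (hd : 0 ≤ d) : IsTEAPair (a • x + b • y) (c • x + d • y) := by
  have e : a • x + b • y + (c • x + d • y) = (a + c) • x + (b + d) • y := by module
  rw [IsTEAPair, e, h.norm_smul_add_smul ha hb, h.norm_smul_add_smul hc hd,
    h.norm_smul_add_smul (add_nonneg ha hc) (add_nonneg hb hd)]
  ring

theorem IsTEAPair.isParallelPair {E : Type*} [NormedAddCommGroup E] [NormedSpace ℝ E]
    {x y : E} (h : IsTEAPair x y) : IsParallelPair x y :=
  ⟨1, abs_one, by rwa [one_smul]⟩

theorem IsParallelPair.isTEAPair_of_norm_sub_lt {E : Type*} [NormedAddCommGroup E]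
    [NormedSpace ℝ E] {x y : E} (h : IsParallelPair x y) (hlt : ‖y - x‖ < ‖x‖ + ‖y‖) :
    IsTEAPair x y := by
  obtain ⟨lam, hlam, h⟩ := h
  rcases eq_or_eq_neg_of_abs_eq hlam with rfl | rfl
  · rwa [one_smul] at h
  · rw [neg_one_smul, ← sub_eq_add_neg, norm_sub_rev] at h
    exact absurd h hlt.ne

theorem eq_add_mul_of_add_eq_two_mul {a : ℕ → ℝ} {n : ℕ}
    (h : ∀ k, k + 2 ≤ n → a k + a (k + 2) = 2 * a (k + 1)) :
    ∀ k ≤ n, a k = a 0 + k * (a 1 - a 0) := by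
  intro k
  induction k using Nat.twoStepInduction with
  | zero => simp
  | one => simp
  | more k ih₀ ih₁ =>
    intro hk
    have h₀ := ih₀ (by lia)
    have h₁ := ih₁ (by lia)
    have h₂ := h k hk
    push_cast at h₁ ⊢
    linarith

theorem IsTEAPair.map_of_preserves_parallel {X Y : Type*} [NormedAddCommGroup X]
    [NormedSpace ℝ X] [FiniteDimensional ℝ X] [NormedAddCommGroup Y] [NormedSpace ℝ Y]
    {T : X →L[ℝ] Y} (hT : Function.Injective T)
    (hpar : ∀ x y : X, IsParallelPair x y → IsParallelPair (T x) (T y))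
    {x y : X} (h : IsTEAPair x y) : IsTEAPair (T x) (T y) := by
  rcases eq_or_ne x 0 with rfl | hx
  · simp [IsTEAPair]
  rcases eq_or_ne y 0 with rfl | hy
  · simp [IsTEAPair]
  obtain ⟨K, hK, hanti⟩ :=
    (T : X →ₗ[ℝ] Y).exists_antilipschitzWith (LinearMap.ker_eq_bot.2 hT)
  have hbound : ∀ z, ‖z‖ ≤ K * ‖T z‖ := fun z => by simpa using hanti.le_mul_dist z 0
  have hK' : (0 : ℝ) < K := hK
  set m := min ‖x‖ ‖y‖ with hm
  have hm0 : 0 < m := lt_min (norm_pos_iff.2 hx) (norm_pos_iff.2 hy)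
  obtain ⟨M, hM⟩ := exists_nat_gt (K * ‖T (y - x)‖ / m)
  have hM' : K * ‖T (y - x)‖ < M * m := (div_lt_iff₀ hm0).1 hM
  have hM0 : (0 : ℝ) < M := lt_of_le_of_lt (by positivity) hM
  let p : ℕ → X := fun k => (2 * M - k : ℝ) • x + (k : ℝ) • y
  have hnorm : ∀ k ≤ 2 * M, 2 * M * m ≤ K * ‖T (p k)‖ := by
    intro k hk
    have hk' : (k : ℝ) ≤ 2 * M := by exact_mod_cast hk
    have hp : ‖p k‖ = (2 * M - k : ℝ) * ‖x‖ + k * ‖y‖ :=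
      h.norm_smul_add_smul (sub_nonneg.2 hk') k.cast_nonneg
    have h₁ := mul_le_mul_of_nonneg_left (min_le_left ‖x‖ ‖y‖) (sub_nonneg.2 hk')
    have h₂ := mul_le_mul_of_nonneg_left (min_le_right ‖x‖ ‖y‖) (k.cast_nonneg (α := ℝ))
    rw [← hm] at h₁ h₂
    linarith [hbound (p k)]
  have hstep : ∀ k, k + 2 ≤ 2 * M →
      ‖T (p k)‖ + ‖T (p (k + 2))‖ = 2 * ‖T (p (k + 1))‖ := by
    intro k hk
    have hk' : (k : ℝ) + 2 ≤ 2 * M := by exact_mod_cast hk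
    have hpair : IsTEAPair (p k) (p (k + 2)) :=
      h.conical_combinations (by linarith) (by positivity) (by push_cast; linarith)
        (by positivity)
    have hsub : T (p (k + 2)) - T (p k) = (2 : ℝ) • T (y - x) := by
      rw [← map_sub, ← map_smul]
      congr 1
      simp only [p]
      push_cast
      module
    have hadd : T (p k) + T (p (k + 2)) = (2 : ℝ) • T (p (k + 1)) := by
      rw [← map_add, ← map_smul]
      congr 1
      simp only [p]
      push_cast
      module
    have htea := (hpar _ _ hpair.isParallelPair).isTEAPair_of_norm_sub_lt (by
      rw [hsub, norm_smul_of_nonneg zero_le_two]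
      refine lt_of_mul_lt_mul_left ?_ hK'.le
      nlinarith [hnorm k (by lia), hnorm (k + 2) hk])
    rw [← htea, hadd, norm_smul_of_nonneg zero_le_two]
  have hlin := eq_add_mul_of_add_eq_two_mul (a := fun k => ‖T (p k)‖) hstep
  have hmid := hlin M (by lia)
  have hend := hlin (2 * M) le_rfl
  have h0 : ‖T (p 0)‖ = 2 * M * ‖T x‖ := by
    simp [p, norm_smul]
  have h1 : ‖T (p (2 * M))‖ = 2 * M * ‖T y‖ := by
    simp [p, norm_smul]
  have h2 : ‖T (p M)‖ = M * ‖T x + T y‖ := by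
    have e : p M = (M : ℝ) • (x + y) := by simp only [p]; module
    rw [e, map_smul, norm_smul_of_nonneg hM0.le, map_add]
  simp only [h0, h1, h2] at hmid hend
  push_cast at hend
  refine mul_left_cancel₀ hM0.ne' ?_
  linarith

theorem norm_smul_of_abs_eq_one {E : Type*} [NormedAddCommGroup E] [NormedSpace ℝ E]
    {lam : ℝ} (hlam : |lam| = 1) (z : E) : ‖lam • z‖ = ‖z‖ := by
  rw [norm_smul, Real.norm_eq_abs, hlam, one_mul]

theorem bijective_preserves_parallel_iff_preserves_tea
    {X Y : Type*} [NormedAddCommGroup X] [NormedSpace ℝ X] [FiniteDimensional ℝ X]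
    [NormedAddCommGroup Y] [NormedSpace ℝ Y] [FiniteDimensional ℝ Y]
    (hdimX : 1 < Module.finrank ℝ X) (hdimY : 1 < Module.finrank ℝ Y)
    (T : X →L[ℝ] Y) (hT : Function.Bijective T) :
    (∀ x y : X, IsParallelPair x y → IsParallelPair (T x) (T y)) ↔
      (∀ x y : X, IsTEAPair x y → IsTEAPair (T x) (T y)) := by
  refine ⟨fun hpar x y h => h.map_of_preserves_parallel hT.injective hpar, ?_⟩
  rintro htea x y ⟨lam, hlam, h⟩
  refine ⟨lam, hlam, ?_⟩
  have hmap := htea x (lam • y) (by rw [IsTEAPair, h, norm_smul_of_abs_eq_one hlam])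
  rwa [IsTEAPair, map_smul, norm_smul_of_abs_eq_one hlam] at hmap
end
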